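/- arXiv:2003.13758 — 3 statements merged into one kernel-verified Lean document; each statement's English description precedes it below -/
import Mathlib

section
/- Let f : X → Y be a locally L-bilipschitz map between metric spaces, let α : [0,1] → Y be a rectifiable path, and let β : [0,1] → X be a continuous path with f ∘ β = α. Then β is rectifiable with length(β) ≤ L·length(α); in particular d(β(t), β(0)) ≤ L·length(α) for all t ∈ [0,1]. -/
open Metric MeasureTheory Set Filter

/-- A map between metric spaces is *locally `L`-bilipschitz* (`L ≥ 1`) if every point has a
neighborhood `U` such that `L⁻¹ * d a b ≤ d (f a) (f b) ≤ L * d a b` for all `a b ∈ U`. -/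
def LocallyBilipschitzWith {X Y : Type*} [MetricSpace X] [MetricSpace Y]
    (L : ℝ) (f : X → Y) : Prop :=
  ∀ x : X, ∃ U ∈ nhds x, ∀ a ∈ U, ∀ b ∈ U,
    L⁻¹ * dist a b ≤ dist (f a) (f b) ∧ dist (f a) (f b) ≤ L * dist a b

/-- A metric space is a *path-metric space* if the distance between any two points is the
infimum of the lengths (total variations) of continuous paths joining them. -/
def IsPathMetric (X : Type*) [MetricSpace X] : Prop :=
  ∀ x y : X, ENNReal.ofReal (dist x y) =
    ⨅ γ : {γ : ℝ → X // ContinuousOn γ (Set.Icc 0 1) ∧ γ 0 = x ∧ γ 1 = y},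
      eVariationOn γ.1 (Set.Icc 0 1)

/-- A Borel measure `μ` on a metric space is *uniformly locally Ahlfors `q`-regular* if there
are constants `C ≥ 1` and `r₀ > 0` with `C⁻¹ * r ^ q ≤ μ (B (x, r)) ≤ C * r ^ q` for all `x`
and all `0 < r < r₀`. -/
def UnifLocAhlforsRegular {X : Type*} [MetricSpace X] [MeasurableSpace X]
    (μ : Measure X) (q : ℝ) : Prop :=
  ∃ C r₀ : ℝ, 1 ≤ C ∧ 0 < r₀ ∧ ∀ (x : X) (r : ℝ), 0 < r → r < r₀ →
    ENNReal.ofReal (C⁻¹ * r ^ q) ≤ μ (Metric.ball x r) ∧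
      μ (Metric.ball x r) ≤ ENNReal.ofReal (C * r ^ q)

/-- A map between metric spaces is an *`L`-LQ (Lipschitz quotient) map* if
`B (f x, r / L) ⊆ f '' B (x, r) ⊆ B (f x, L * r)` for every `x` and every `r > 0`. -/
def IsLQMapWith {X Y : Type*} [MetricSpace X] [MetricSpace Y] (L : ℝ) (f : X → Y) : Prop :=
  ∀ (x : X) (r : ℝ), 0 < r →
    Metric.ball (f x) (r / L) ⊆ f '' Metric.ball x r ∧
      f '' Metric.ball x r ⊆ Metric.ball (f x) (L * r)

/-- A pointwise comparison of increments passes to the total variation. -/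
theorem eVariationOn_le_mul_of_edist_le {ι E F : Type*} [LinearOrder ι]
    [PseudoEMetricSpace E] [PseudoEMetricSpace F] {g : ι → E} {h : ι → F} {s : Set ι}
    {C : ENNReal} (hgh : ∀ a ∈ s, ∀ b ∈ s, edist (g a) (g b) ≤ C * edist (h a) (h b)) :
    eVariationOn g s ≤ C * eVariationOn h s := by
  refine iSup_le ?_
  rintro ⟨n, u, hu, us⟩
  calc ∑ i ∈ Finset.range n, edist (g (u (i + 1))) (g (u i))
      ≤ ∑ i ∈ Finset.range n, C * edist (h (u (i + 1))) (h (u i)) :=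
        Finset.sum_le_sum fun i _ => hgh _ (us _) _ (us _)
    _ = C * ∑ i ∈ Finset.range n, edist (h (u (i + 1))) (h (u i)) := by rw [Finset.mul_sum]
    _ ≤ C * eVariationOn h s := by
        gcongr
        exact eVariationOn.sum_le hu us

/-- On the unit interval, a local comparison of increments passes to the total variation. -/
theorem eVariationOn_univ_le_mul_of_locally_edist_le {E F : Type*}
    [PseudoEMetricSpace E] [PseudoEMetricSpace F] {g : unitInterval → E} {h : unitInterval → F}
    {C : ENNReal}
    (hgh : ∀ t, ∃ V ∈ nhds t, ∀ a ∈ V, ∀ b ∈ V, edist (g a) (g b) ≤ C * edist (h a) (h b)) :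
    eVariationOn g Set.univ ≤ C * eVariationOn h Set.univ := by
  choose V hV hgV using hgh
  obtain ⟨t, ht₀, ht, ⟨n, hn⟩, htV⟩ :=
    exists_monotone_Icc_subset_open_cover_unitInterval
      (c := fun x => interior (V x)) (fun _ => isOpen_interior)
      (fun x _ => Set.mem_iUnion.2 ⟨x, mem_interior_iff_mem_nhds.2 (hV x)⟩)
  have huniv : (Set.univ : Set unitInterval) = Set.Icc (t 0) (t n) := by
    rw [ht₀, hn n le_rfl]
    exact Set.Icc_bot_top.symm
  rw [huniv, ← eVariationOn.sum' g ht, ← eVariationOn.sum' h ht, Finset.mul_sum]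
  refine Finset.sum_le_sum fun i _ => eVariationOn_le_mul_of_edist_le fun a ha b hb => ?_
  obtain ⟨x, hx⟩ := htV i
  exact hgV x a (interior_subset (hx ha)) b (interior_subset (hx hb))

/-- Lifts of rectifiable paths through locally `L`-bilipschitz maps are
rectifiable, with length at most `L` times the length of the original path; in particular
the lift stays within distance `L * length α` of its starting point. -/
theorem lift_length_bound
    {X Y : Type*} [MetricSpace X] [MetricSpace Y]
    (L : ℝ) (hL : 1 ≤ L) (f : X → Y) (hf : LocallyBilipschitzWith L f)
    (α : unitInterval → Y) (hα : Continuous α)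
    (hrect : eVariationOn α Set.univ ≠ ⊤)
    (β : unitInterval → X) (hβ : Continuous β) (hlift : f ∘ β = α) :
    eVariationOn β Set.univ ≤ ENNReal.ofReal L * eVariationOn α Set.univ ∧
      ∀ t : unitInterval,
        ENNReal.ofReal (dist (β t) (β 0)) ≤ ENNReal.ofReal L * eVariationOn α Set.univ := by
  have hL₀ : 0 < L := zero_lt_one.trans_le hL
  have hlength : eVariationOn β Set.univ ≤ ENNReal.ofReal L * eVariationOn α Set.univ := by
    refine eVariationOn_univ_le_mul_of_locally_edist_le fun t => ?_
    obtain ⟨U, hU, hfU⟩ := hf (β t)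
    refine ⟨β ⁻¹' U, hβ.continuousAt hU, fun a ha b hb => ?_⟩
    rw [← hlift, edist_dist, edist_dist, ← ENNReal.ofReal_mul hL₀.le]
    exact ENNReal.ofReal_le_ofReal ((inv_mul_le_iff₀ hL₀).1 (hfU _ ha _ hb).1)
  refine ⟨hlength, fun t => ?_⟩
  rw [← edist_dist]
  exact (eVariationOn.edist_le β (Set.mem_univ t) (Set.mem_univ 0)).trans hlength
end

section
/- Let f : X → Y be a local homeomorphism between metric spaces, let α : [0,1] → Y be continuous, and let β : [0,1) → X be continuous with f(β(t)) = α(t) for all t ∈ [0,1). If the image β([0,1)) is contained in a compact subset of X, then the limit lim_{t→1⁻} β(t) exists in X. -/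
open Metric MeasureTheory Set Filter

/-- A partial lift `β : [0,1) → X` of a continuous path `α : [0,1] → Y`
through a local homeomorphism has a limit at `1⁻` provided its image lies in a compact set. -/
theorem partial_lift_limit_of_compact
    {X Y : Type*} [MetricSpace X] [MetricSpace Y]
    (f : X → Y) (hf : IsLocalHomeomorph f)
    (α : ℝ → Y) (hα : ContinuousOn α (Set.Icc 0 1))
    (β : ℝ → X) (hβ : ContinuousOn β (Set.Ico 0 1))
    (hlift : ∀ t ∈ Set.Ico (0 : ℝ) 1, f (β t) = α t)
    (K : Set X) (hK : IsCompact K) (him : β '' Set.Ico 0 1 ⊆ K) :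
    ∃ x : X, Filter.Tendsto β (nhdsWithin 1 (Set.Ico 0 1)) (nhds x) := by
  have hne : (nhdsWithin (1 : ℝ) (Set.Ico 0 1)).NeBot := by
    rw [← mem_closure_iff_nhdsWithin_neBot, closure_Ico zero_ne_one]
    exact right_mem_Icc.mpr zero_le_one
  have hαlim : Tendsto α (nhdsWithin 1 (Set.Ico 0 1)) (nhds (α 1)) :=
    (hα 1 (right_mem_Icc.mpr zero_le_one)).mono_left (nhdsWithin_mono _ Ico_subset_Icc_self)
  have hfβ : Tendsto (f ∘ β) (nhdsWithin 1 (Set.Ico 0 1)) (nhds (α 1)) :=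
    hαlim.congr' (eventually_mem_nhdsWithin.mono fun t ht => (hlift t ht).symm)
  obtain ⟨x, -, hx⟩ := hK (f := map β (nhdsWithin 1 (Set.Ico 0 1))) <| by
    rw [le_principal_iff, mem_map]
    exact eventually_mem_nhdsWithin.mono fun t ht => him (mem_image_of_mem β ht)
  have hfx : f x = α 1 := by
    have h := hx.map hf.continuous.continuousAt tendsto_map
    rw [map_map] at h
    have := h.neBot
    exact eq_of_nhds_neBot (h.neBot.mono (inf_le_inf_left _ hfβ))
  obtain ⟨e, hxe, rfl⟩ := hf x
  have hα1 : α 1 ∈ e.target := hfx ▸ e.map_source hxe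
  obtain ⟨t₀, ht₀, hsub⟩ : ∃ t₀ < (1 : ℝ), ∀ t ∈ Ico 0 1, t₀ < t → α t ∈ e.target := by
    have h := hαlim (e.open_target.mem_nhds hα1)
    rw [mem_map, mem_nhdsWithin_iff_exists_mem_nhds_inter] at h
    obtain ⟨u, hu, hsub⟩ := h
    obtain ⟨t₀, ht₀, ht₀u⟩ := exists_Ioc_subset_of_mem_nhds hu ⟨0, zero_lt_one⟩
    exact ⟨t₀, ht₀, fun t ht hlt => hsub ⟨ht₀u ⟨hlt, ht.2.le⟩, ht⟩⟩
  obtain ⟨s, hsβ, hs, hts⟩ : ∃ s, β s ∈ e.source ∧ s ∈ Ico 0 1 ∧ t₀ < s := by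
    have h : ∃ᶠ t in nhdsWithin 1 (Set.Ico 0 1), β t ∈ e.source :=
      hx.frequently (e.open_source.mem_nhds hxe)
    exact (h.and_eventually (eventually_mem_nhdsWithin.and
      (eventually_nhdsWithin_of_eventually_nhds (eventually_gt_nhds ht₀)))).exists
  have hI : Ico s 1 ⊆ Ico 0 1 := Ico_subset_Ico_left hs.1
  have htgt : MapsTo α (Ico s 1) e.target := fun t ht => hsub t (hI ht) (hts.trans_le ht.1)
  have heq : EqOn β (e.symm ∘ α) (Ico s 1) := by
    refine (T2Space.isSeparatedMap e).eqOn_of_comp_eqOn hf.isLocallyInjective isPreconnected_Ico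
      (hβ.mono hI) (e.continuousOn_symm.comp (hα.mono (hI.trans Ico_subset_Icc_self)) htgt)
      (fun t ht => ?_) (left_mem_Ico.mpr hs.2) ?_
    · simp [e.right_inv (htgt ht), hlift t (hI ht)]
    · simp [← hlift s hs, e.left_inv hsβ]
  refine ⟨e.symm (α 1), ((e.continuousAt_symm hα1).tendsto.comp hαlim).congr' ?_⟩
  filter_upwards [eventually_mem_nhdsWithin,
    eventually_nhdsWithin_of_eventually_nhds (eventually_gt_nhds hs.2)] with t ht hst
  exact (heq ⟨hst.le, ht.2⟩).symm
end

section
/- Let f : X → Y be an L-LQ map between metric spaces and let β : [0,1) → X be a continuous path such that lim_{t→1⁻} f(β(t)) exists in Y but β escapes to infinity, i.e. sup_{t ∈ [0,1)} d(β(0), β(t)) = ∞. Then f has unbounded multiplicity at every scale: for every R > 0 and every k ∈ ℕ there exist x ∈ X and y ∈ Y such that the set f⁻¹({y}) ∩ B(x,R) contains at least k points. -/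
open Metric MeasureTheory Set Filter

theorem IsLQMapWith.pos {X Y : Type*} [MetricSpace X] [MetricSpace Y] {L : ℝ} {f : X → Y}
    (hf : IsLQMapWith L f) (x : X) : 0 < L := by
  have h := (hf x 1 one_pos).2 (mem_image_of_mem f (mem_ball_self one_pos))
  simpa using h

/-- A path on `[0, 1)` that escapes to infinity gets arbitrarily far from each of its points at
some later time. -/
theorem exists_far_of_escaping {X : Type*} [MetricSpace X] {β : ℝ → X}
    (hβ : ContinuousOn β (Set.Ico 0 1))
    (hesc : ∀ M : ℝ, ∃ t ∈ Set.Ico (0 : ℝ) 1, M ≤ dist (β 0) (β t))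
    {t₀ : ℝ} (ht₀ : t₀ ∈ Set.Ico (0 : ℝ) 1) (R : ℝ) :
    ∃ s ∈ Set.Ico t₀ 1, R ≤ dist (β t₀) (β s) := by
  have hcont : ContinuousOn (fun t => dist (β 0) (β t)) (Set.Icc 0 t₀) :=
    continuous_dist.comp_continuousOn (continuousOn_const.prodMk <| hβ.mono fun t ht => ⟨ht.1, ht.2.trans_lt ht₀.2⟩)
  obtain ⟨M, hM⟩ := isCompact_Icc.bddAbove_image hcont
  obtain ⟨s, hs, hfar⟩ := hesc (max (M + 1) (dist (β 0) (β t₀) + R))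
  refine ⟨s, ⟨?_, hs.2⟩, ?_⟩
  · by_contra! hlt
    have := hM (mem_image_of_mem _ (⟨hs.1, hlt.le⟩ : s ∈ Set.Icc 0 t₀))
    linarith [(le_max_left _ _).trans hfar]
  · linarith [(le_max_right _ _).trans hfar, dist_triangle (β 0) (β t₀) (β s)]

/-- If a path escapes to infinity under an `L`-LQ map while its image
converges, then the map has unbounded multiplicity at every scale. -/
theorem escaping_lift_unbounded_multiplicity
    {X Y : Type*} [MetricSpace X] [MetricSpace Y]
    (L : ℝ) (f : X → Y) (hf : IsLQMapWith L f)
    (β : ℝ → X) (hβ : ContinuousOn β (Set.Ico 0 1))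
    (y₀ : Y)
    (hconv : Filter.Tendsto (fun t => f (β t)) (nhdsWithin 1 (Set.Ico 0 1)) (nhds y₀))
    (hesc : ∀ M : ℝ, ∃ t ∈ Set.Ico (0 : ℝ) 1, M ≤ dist (β 0) (β t)) :
    ∀ R : ℝ, 0 < R → ∀ k : ℕ, ∃ (x : X) (y : Y) (S : Finset X),
      ↑S ⊆ f ⁻¹' {y} ∩ Metric.ball x R ∧ k ≤ S.card := by
  intro R hR k
  obtain ⟨t₀, ht₀, hclose⟩ : ∃ t₀ ∈ Set.Ico (0 : ℝ) 1, ∀ t ∈ Set.Ico t₀ 1,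
      dist (f (β t)) y₀ < R / (4 * (k + 1)) / L := by
    have hδ : 0 < R / (4 * (k + 1)) / L := div_pos (by positivity) (hf.pos (β 0))
    obtain ⟨ε, hε, h⟩ := Metric.mem_nhdsWithin_iff.1 (hconv (Metric.ball_mem_nhds y₀ hδ))
    refine ⟨max 0 (1 - ε / 2), ⟨le_max_left _ _, max_lt one_pos (by linarith)⟩, ?_⟩
    rintro t ⟨ht, ht1⟩
    have h0 := (le_max_left _ _).trans ht
    have h1 := (le_max_right _ _).trans ht
    refine h ⟨?_, h0, ht1⟩
    rw [Metric.mem_ball, Real.dist_eq, abs_lt]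
    constructor <;> linarith
  obtain ⟨s, hs, hfar⟩ := exists_far_of_escaping hβ hesc ht₀ R
  have hη : 0 < R / (4 * (k + 1)) := by positivity
  have hRη : R = 4 * (k + 1) * (R / (4 * (k + 1))) := by field_simp
  set η := R / (4 * (k + 1))
  have hcont : ContinuousOn (fun t => dist (β t₀) (β t)) (Set.Icc t₀ s) :=
    continuous_dist.comp_continuousOn (continuousOn_const.prodMk <| hβ.mono fun t ht => ⟨ht₀.1.trans ht.1, ht.2.trans_lt hs.2⟩)
  have hlift : ∀ j : Fin k, ∃ z, f z = y₀ ∧ |dist (β t₀) z - 2 * j * η| < η := by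
    intro j
    have hj : (j : ℝ) < k := by exact_mod_cast j.2
    have hjη : (j : ℝ) * η < k * η := mul_lt_mul_of_pos_right hj hη
    have hj0 : 0 ≤ (j : ℝ) * η := by positivity
    have hk0 : 0 ≤ (k : ℝ) * η := by positivity
    obtain ⟨t, ht, hdist⟩ := intermediate_value_Icc hs.1 hcont
      (show 2 * j * η ∈ Set.Icc _ _ by
        constructor
        · simp only [dist_self]; linarith
        · exact le_trans (by linarith) hfar)
    have hy : y₀ ∈ Metric.ball (f (β t)) (η / L) := by
      rw [Metric.mem_ball, dist_comm]
      exact hclose t ⟨ht.1, ht.2.trans_lt hs.2⟩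
    obtain ⟨z, hz, hfz⟩ := (hf (β t) η hη).1 hy
    refine ⟨z, hfz, ?_⟩
    rw [← hdist]
    have := abs_dist_sub_le z (β t) (β t₀)
    rw [dist_comm z (β t₀), dist_comm (β t) (β t₀)] at this
    exact this.trans_lt hz
  choose z hfz hz using hlift
  have hinj : Function.Injective z := by
    intro i j hij
    have hi := abs_lt.1 (hz i)
    have hj := abs_lt.1 (hz j)
    rw [hij] at hi
    have h1 : (i : ℝ) < j + 1 := lt_of_mul_lt_mul_right (by linarith) hη.le
    have h2 : (j : ℝ) < i + 1 := lt_of_mul_lt_mul_right (by linarith) hη.le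
    norm_cast at h1 h2
    omega
  refine ⟨β t₀, y₀, Finset.univ.map ⟨z, hinj⟩, ?_, by simp⟩
  intro w hw
  obtain ⟨j, rfl⟩ : ∃ j, z j = w := by simpa using hw
  refine ⟨hfz j, ?_⟩
  have hj : (j : ℝ) < k := by exact_mod_cast j.2
  have hjη : (j : ℝ) * η < k * η := mul_lt_mul_of_pos_right hj hη
  have hk0 : 0 ≤ (k : ℝ) * η := by positivity
  have := (abs_lt.1 (hz j)).2
  rw [Metric.mem_ball, dist_comm]
  linarith
end
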